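/- arXiv:1306.1751 — 4 statements merged into one kernel-verified Lean document; each statement's English description precedes it below -/
import Mathlib

section
/- Define S(x,y) := sup{d₁ + d₂ : (d₁,d₂) ∈ R(x,y)} for 0 ≤ y ≤ x ≤ 1. Then for all a, b ∈ ℝ with 0 ≤ b ≤ a ≤ 1, the 'symmetry gain' satisfies S((a+b)/2, (a+b)/2) − S(a,b) = (1/6)·max(2a − b − 1, 0). In particular, if 2a − b − 1 > 0 the symmetric configuration with both exponents equal to (a+b)/2 has strictly larger sum DoF than the asymmetric configuration (a,b), and otherwise there is no symmetry gain. -/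
/-- The DoF region of the two-user MISO BC with sufficiently good delayed CSIT. -/
def dofRegion (a b : ℝ) : Set (ℝ × ℝ) :=
  {p : ℝ × ℝ | 0 ≤ p.1 ∧ p.1 ≤ 1 ∧ 0 ≤ p.2 ∧ p.2 ≤ 1 ∧
    2 * p.1 + p.2 ≤ 2 + a ∧ 2 * p.2 + p.1 ≤ 2 + b}

/-- The optimal sum DoF: supremum of `d₁ + d₂` over the DoF region. -/
noncomputable def sumDoF (a b : ℝ) : ℝ :=
  sSup ((fun p : ℝ × ℝ => p.1 + p.2) '' dofRegion a b)

theorem sumDoF_eq_of_isGreatest {a b s : ℝ}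
    (h : IsGreatest ((fun p : ℝ × ℝ => p.1 + p.2) '' dofRegion a b) s) : sumDoF a b = s :=
  h.csSup_eq

/-- When `2a - b ≤ 1`, the sum DoF is attained where the two weighted bounds meet. -/
theorem sumDoF_of_le {a b : ℝ} (hb : 0 ≤ b) (hba : b ≤ a) (ha : a ≤ 1)
    (h : 2 * a - b - 1 ≤ 0) : sumDoF a b = (4 + a + b) / 3 := by
  refine sumDoF_eq_of_isGreatest
    ⟨⟨((2 + 2 * a - b) / 3, (2 + 2 * b - a) / 3), ?_, by ring⟩, ?_⟩
  · refine ⟨?_, ?_, ?_, ?_, ?_, ?_⟩ <;> dsimp only <;> linarith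
  · rintro _ ⟨p, ⟨_, _, _, _, _, _⟩, rfl⟩
    dsimp only
    linarith

/-- When `2a - b ≥ 1`, the sum DoF is attained at `d₁ = 1`. -/
theorem sumDoF_of_ge {a b : ℝ} (hb : 0 ≤ b) (hba : b ≤ a) (ha : a ≤ 1)
    (h : 0 ≤ 2 * a - b - 1) : sumDoF a b = (3 + b) / 2 := by
  refine sumDoF_eq_of_isGreatest ⟨⟨(1, (1 + b) / 2), ?_, by ring⟩, ?_⟩
  · refine ⟨?_, ?_, ?_, ?_, ?_, ?_⟩ <;> dsimp only <;> linarith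
  · rintro _ ⟨p, ⟨_, _, _, _, _, _⟩, rfl⟩
    dsimp only
    linarith

theorem stmt_2 (a b : ℝ) (hb : 0 ≤ b) (hba : b ≤ a) (ha : a ≤ 1) :
    sumDoF ((a + b) / 2) ((a + b) / 2) - sumDoF a b
        = (1 / 6) * max (2 * a - b - 1) 0 ∧
      (2 * a - b - 1 > 0 → sumDoF a b < sumDoF ((a + b) / 2) ((a + b) / 2)) ∧
      (2 * a - b - 1 ≤ 0 → sumDoF ((a + b) / 2) ((a + b) / 2) = sumDoF a b) := by
  have hsymm : sumDoF ((a + b) / 2) ((a + b) / 2) = (4 + (a + b) / 2 + (a + b) / 2) / 3 :=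
    sumDoF_of_le (by linarith) le_rfl (by linarith) (by linarith)
  have hgain : sumDoF ((a + b) / 2) ((a + b) / 2) - sumDoF a b
      = (1 / 6) * max (2 * a - b - 1) 0 := by
    rcases le_total (2 * a - b - 1) 0 with h | h
    · rw [hsymm, sumDoF_of_le hb hba ha h, max_eq_right h]
      ring
    · rw [hsymm, sumDoF_of_ge hb hba ha h, max_eq_left h]
      ring
  refine ⟨hgain, fun h => ?_, fun h => ?_⟩
  · rw [max_eq_left h.le] at hgain
    linarith
  · rw [max_eq_right h] at hgain
    linarith
end

section
/- Let ᾱ, β̄ ∈ ℝ with 0 ≤ ᾱ ≤ β̄ ≤ (1 + 2ᾱ)/3. Then the set {(d₁,d₂) ∈ ℝ² : 0 ≤ d₁ ≤ 1, 0 ≤ d₂ ≤ 1, 2d₁ + d₂ ≤ 2 + ᾱ, 2d₂ + d₁ ≤ 2 + ᾱ, d₁ + d₂ ≤ 1 + β̄} equals the convex hull in ℝ² of the seven points {(0,0), (0,1), (ᾱ,1), (2β̄−ᾱ, 1+ᾱ−β̄), (1+ᾱ−β̄, 2β̄−ᾱ), (1,ᾱ), (1,0)}. -/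
/-- A convex set containing the origin and the points `(a, b)`, `(c, d)` contains every point of
the triangle they span, described through two-dimensional cross products. -/
theorem Convex.mem_of_mem_triangle {S : Set (ℝ × ℝ)} (hS : Convex ℝ S) (h0 : ((0 : ℝ), (0 : ℝ)) ∈ S)
    {a b c d x y : ℝ} (hA : (a, b) ∈ S) (hB : (c, d) ∈ S) (hx : 0 ≤ x * d - y * c)
    (hy : 0 ≤ a * y - b * x) (hD : 0 < a * d - b * c)
    (h : (x * d - y * c) + (a * y - b * x) ≤ a * d - b * c) : (x, y) ∈ S := by
  have hr : 0 ≤ 1 - (x * d - y * c) / (a * d - b * c) - (a * y - b * x) / (a * d - b * c) := by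
    have := (div_le_one hD).2 h
    rw [add_div] at this
    linarith
  have key := hS.sum_mem (t := Finset.univ)
    (w := ![1 - (x * d - y * c) / (a * d - b * c) - (a * y - b * x) / (a * d - b * c),
      (x * d - y * c) / (a * d - b * c), (a * y - b * x) / (a * d - b * c)])
    (z := ![(0, 0), (a, b), (c, d)])
    (by
      intro i _
      fin_cases i
      · exact hr
      · exact div_nonneg hx hD.le
      · exact div_nonneg hy hD.le)
    (by simp [Fin.sum_univ_three]; ring)
    (by
      intro i _
      fin_cases i
      · exact h0
      · exact hA
      · exact hB)
  convert key using 1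
  have hD' := hD.ne'
  ext
  · simp [Fin.sum_univ_three]
    rw [div_mul_eq_mul_div, div_mul_eq_mul_div, ← add_div, eq_div_iff hD']
    ring
  · simp [Fin.sum_univ_three]
    rw [div_mul_eq_mul_div, div_mul_eq_mul_div, ← add_div, eq_div_iff hD']
    ring

theorem stmt_9 (α β : ℝ) (h0 : 0 ≤ α) (hαβ : α ≤ β) (hβ : β ≤ (1 + 2 * α) / 3) :
    {p : ℝ × ℝ | 0 ≤ p.1 ∧ p.1 ≤ 1 ∧ 0 ≤ p.2 ∧ p.2 ≤ 1 ∧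
        2 * p.1 + p.2 ≤ 2 + α ∧ 2 * p.2 + p.1 ≤ 2 + α ∧ p.1 + p.2 ≤ 1 + β} =
      convexHull ℝ
        ({((0 : ℝ), (0 : ℝ)), (0, 1), (α, 1),
          (2 * β - α, 1 + α - β), (1 + α - β, 2 * β - α),
          (1, α), (1, 0)} : Set (ℝ × ℝ)) := by
  apply Set.Subset.antisymm
  · rintro ⟨x, y⟩ ⟨hx0, hx1, hy0, hy1, h1, h2, h3⟩
    dsimp only at hx0 hx1 hy0 hy1 h1 h2 h3
    set V : Set (ℝ × ℝ) := {((0 : ℝ), (0 : ℝ)), (0, 1), (α, 1),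
          (2 * β - α, 1 + α - β), (1 + α - β, 2 * β - α), (1, α), (1, 0)} with hV
    have hS : Convex ℝ (convexHull ℝ V) := convex_convexHull ℝ V
    have hsub : V ⊆ convexHull ℝ V := subset_convexHull ℝ V
    have m0 : ((0 : ℝ), (0 : ℝ)) ∈ convexHull ℝ V := hsub (by simp [hV])
    have m1 : ((0 : ℝ), (1 : ℝ)) ∈ convexHull ℝ V := hsub (by simp [hV])
    have m2 : (α, (1 : ℝ)) ∈ convexHull ℝ V := hsub (by simp [hV])
    have m3 : (2 * β - α, 1 + α - β) ∈ convexHull ℝ V := hsub (by simp [hV])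
    have m4 : (1 + α - β, 2 * β - α) ∈ convexHull ℝ V := hsub (by simp [hV])
    have m5 : ((1 : ℝ), α) ∈ convexHull ℝ V := hsub (by simp [hV])
    have m6 : ((1 : ℝ), (0 : ℝ)) ∈ convexHull ℝ V := hsub (by simp [hV])
    have e1 := mul_nonneg h0 (sub_nonneg.2 hx1)
    have e2 := mul_nonneg (sub_nonneg.2 hαβ) (sub_nonneg.2 h1)
    have e3 := mul_nonneg (show 0 ≤ 1 + 2 * α - 3 * β by linarith) (sub_nonneg.2 h3)
    have e4 := mul_nonneg (sub_nonneg.2 hαβ) (sub_nonneg.2 h2)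
    have e5 := mul_nonneg h0 (sub_nonneg.2 hy1)
    rcases hy0.eq_or_lt with hy | hy
    · exact hS.mem_of_mem_triangle m0 m6 m1 (by linarith) (by linarith) (by norm_num)
        (by linarith)
    rcases le_or_gt (1 * y - α * x) 0 with c5 | c5
    · exact hS.mem_of_mem_triangle m0 m6 m5 (by linarith) (by linarith) (by linarith)
        (by linarith)
    rcases le_or_gt ((1 + α - β) * y - (2 * β - α) * x) 0 with c4 | c4
    · exact hS.mem_of_mem_triangle m0 m5 m4 (by linarith) (by linarith) (by linarith)
        (by linarith)
    rcases le_or_gt ((2 * β - α) * y - (1 + α - β) * x) 0 with c3 | c3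
    · exact hS.mem_of_mem_triangle m0 m4 m3 (by linarith) (by linarith) (by linarith)
        (by linarith)
    rcases le_or_gt (α * y - 1 * x) 0 with c2 | c2
    · exact hS.mem_of_mem_triangle m0 m3 m2 (by linarith) (by linarith) (by linarith)
        (by linarith)
    · exact hS.mem_of_mem_triangle m0 m2 m1 (by linarith) (by linarith) (by linarith)
        (by linarith)
  · apply convexHull_min
    · rintro p hp
      simp only [Set.mem_insert_iff, Set.mem_singleton_iff] at hp
      rcases hp with rfl | rfl | rfl | rfl | rfl | rfl | rfl <;>
        refine ⟨?_, ?_, ?_, ?_, ?_, ?_, ?_⟩ <;> dsimp only <;> linarith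
    · rintro ⟨x, y⟩ ⟨hx0, hx1, hy0, hy1, h1, h2, h3⟩ ⟨z, w⟩ ⟨gx0, gx1, gy0, gy1, g1, g2, g3⟩
        a b ha hb hab
      dsimp only at hx0 hx1 hy0 hy1 h1 h2 h3 gx0 gx1 gy0 gy1 g1 g2 g3
      obtain rfl : b = 1 - a := by linarith
      refine ⟨?_, ?_, ?_, ?_, ?_, ?_, ?_⟩ <;>
        simp only [Prod.smul_mk, Prod.mk_add_mk, smul_eq_mul] <;> nlinarith
end

section
/- Let α₁, α₂, β ∈ ℝ with 0 ≤ α₂ ≤ α₁ ≤ 1 and 0 ≤ β ≤ 1, let δ ∈ ℝ with 0 ≤ δ ≤ min{β, (1 + α₁ + α₂)/3, (1 + α₂)/2}, and let ω ∈ [0,1]. Define Δ := 1 − δ − (δ − α₁)⁺ − (δ − α₂)⁺, d₁ := δ + (δ − α₂)⁺ + ωΔ, and d₂ := δ + (δ − α₁)⁺ + (1 − ω)Δ. Then 0 ≤ d₁ ≤ 1, 0 ≤ d₂ ≤ 1, 2d₁ + d₂ ≤ 2 + α₁, 2d₂ + d₁ ≤ 2 + α₂, and d₁ + d₂ = 1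 + δ ≤ 1 + β; i.e., every DoF pair produced by the universal scheme's generic rate allocation lies in the inner-bound region of Proposition 1. -/
theorem stmt_11 (α₁ α₂ β : ℝ) (h0 : 0 ≤ α₂) (h21 : α₂ ≤ α₁) (h1 : α₁ ≤ 1)
    (hβ0 : 0 ≤ β) (hβ1 : β ≤ 1)
    (δ : ℝ) (hδ0 : 0 ≤ δ)
    (hδ : δ ≤ min β (min ((1 + α₁ + α₂) / 3) ((1 + α₂) / 2)))
    (ω : ℝ) (hω : ω ∈ Set.Icc (0 : ℝ) 1) :
    let Δ : ℝ := 1 - δ - max (δ - α₁) 0 - max (δ - α₂) 0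
    let d₁ : ℝ := δ + max (δ - α₂) 0 + ω * Δ
    let d₂ : ℝ := δ + max (δ - α₁) 0 + (1 - ω) * Δ
    0 ≤ d₁ ∧ d₁ ≤ 1 ∧ 0 ≤ d₂ ∧ d₂ ≤ 1 ∧
      2 * d₁ + d₂ ≤ 2 + α₁ ∧ 2 * d₂ + d₁ ≤ 2 + α₂ ∧
      d₁ + d₂ = 1 + δ ∧ d₁ + d₂ ≤ 1 + β := by
  obtain ⟨hω0, hω1⟩ := hω
  obtain ⟨hδβ, hδ3, hδ2⟩ : δ ≤ β ∧ δ ≤ (1 + α₁ + α₂) / 3 ∧ δ ≤ (1 + α₂) / 2 := by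
    simpa only [le_min_iff] using hδ
  intro Δ d₁ d₂
  have hΔ : 0 ≤ Δ := by
    simp only [Δ]
    rcases max_cases (δ - α₁) 0 with ⟨h, _⟩ | ⟨h, _⟩ <;>
      rcases max_cases (δ - α₂) 0 with ⟨h', _⟩ | ⟨h', _⟩ <;>
      rw [h, h'] <;> linarith
  have hωΔ : 0 ≤ ω * Δ := mul_nonneg hω0 hΔ
  have hωΔ' : 0 ≤ (1 - ω) * Δ := mul_nonneg (sub_nonneg.2 hω1) hΔ
  have hsplit : ω * Δ + (1 - ω) * Δ = 1 - δ - max (δ - α₁) 0 - max (δ - α₂) 0 := by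
    simp only [Δ]
    ring
  have := le_max_left (δ - α₁) 0
  have := le_max_right (δ - α₁) 0
  have := le_max_left (δ - α₂) 0
  have := le_max_right (δ - α₂) 0
  simp only [d₁, d₂]
  refine ⟨?_, ?_, ?_, ?_, ?_, ?_, ?_, ?_⟩ <;> linarith
end

section
/- Let T be a positive integer and let α, β : {1,…,T} → ℝ satisfy 0 ≤ αₜ ≤ βₜ ≤ 1 for every t. Set ᾱ := (1/T)∑ₜ αₜ and β̄ := (1/T)∑ₜ βₜ. Then for every δ̄ ∈ ℝ with 0 ≤ δ̄ ≤ β̄ there exists δ : {1,…,T} → ℝ such that 0 ≤ δₜ ≤ βₜ for every t, (1/T)∑ₜ δₜ = δ̄, and (1/T)∑ₜ max(δₜ − αₜ, 0) = max(δ̄ − ᾱ, 0). -/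
/-- Any number between `c * ∑ f` and `c * ∑ g` is `c * ∑ δ` for some `δ` lying pointwise between
`f` and `g`. -/
theorem exists_between_mul_sum_eq {ι : Type*} [Fintype ι] {f g : ι → ℝ} (hfg : ∀ i, f i ≤ g i)
    {c z : ℝ} (hf : c * ∑ i, f i ≤ z) (hg : z ≤ c * ∑ i, g i) :
    ∃ δ : ι → ℝ, (∀ i, f i ≤ δ i ∧ δ i ≤ g i) ∧ c * ∑ i, δ i = z := by
  have hz : z ∈ segment ℝ (c * ∑ i, f i) (c * ∑ i, g i) := by
    rw [segment_eq_Icc (hf.trans hg)]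
    exact ⟨hf, hg⟩
  obtain ⟨a, b, ha, hb, hab, rfl⟩ := hz
  obtain rfl : a = 1 - b := by linarith
  refine ⟨fun i => (1 - b) * f i + b * g i, fun i => ⟨?_, ?_⟩, ?_⟩
  · nlinarith [mul_nonneg hb (sub_nonneg.2 (hfg i))]
  · nlinarith [mul_nonneg ha (sub_nonneg.2 (hfg i))]
  · simp only [Finset.sum_add_distrib, ← Finset.mul_sum, smul_eq_mul]
    ring

theorem stmt_13 (T : ℕ) (hT : 0 < T) (α β : Fin T → ℝ)
    (hαβ : ∀ t, 0 ≤ α t ∧ α t ≤ β t ∧ β t ≤ 1)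
    (αbar βbar : ℝ)
    (hαbar : αbar = (1 / (T : ℝ)) * ∑ t, α t)
    (hβbar : βbar = (1 / (T : ℝ)) * ∑ t, β t)
    (δbar : ℝ) (hδ0 : 0 ≤ δbar) (hδβ : δbar ≤ βbar) :
    ∃ δ : Fin T → ℝ,
      (∀ t, 0 ≤ δ t ∧ δ t ≤ β t) ∧
      (1 / (T : ℝ)) * ∑ t, δ t = δbar ∧
      (1 / (T : ℝ)) * ∑ t, max (δ t - α t) 0 = max (δbar - αbar) 0 := by
  subst hαbar hβbar
  rcases le_total δbar ((1 / (T : ℝ)) * ∑ t, α t) with h | h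
  · obtain ⟨δ, hδ, hsum⟩ := exists_between_mul_sum_eq (f := fun _ => 0)
      (fun t => (hαβ t).1) (by simpa using hδ0) h
    refine ⟨δ, fun t => ⟨(hδ t).1, (hδ t).2.trans (hαβ t).2.1⟩, hsum, ?_⟩
    simp only [fun t => max_eq_right (sub_nonpos.2 (hδ t).2), max_eq_right (sub_nonpos.2 h),
      Finset.sum_const_zero, mul_zero]
  · obtain ⟨δ, hδ, hsum⟩ := exists_between_mul_sum_eq (fun t => (hαβ t).2.1) h hδβ
    refine ⟨δ, fun t => ⟨(hαβ t).1.trans (hδ t).1, (hδ t).2⟩, hsum, ?_⟩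
    simp only [fun t => max_eq_left (sub_nonneg.2 (hδ t).1), max_eq_left (sub_nonneg.2 h),
      Finset.sum_sub_distrib, mul_sub, hsum]
end
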